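/- arXiv:2409.19546 — 6 statements merged into one kernel-verified Lean document; each statement's English description precedes it below -/
import Mathlib

section
/- Let b ∈ (4/5, 1], α_n = 1/(n+1)^b, and τ_n = Σ_{k=1}^n α_k(1 − α_k). Then sup_n Σ_{k=1}^{n} |α_k − α_{k+1}| τ_k < ∞, i.e., the series Σ_{k=1}^∞ (α_k − α_{k+1}) τ_k converges (note α_k is strictly decreasing). -/
/-- With α_n = 1/(n+1)^b (α_0 = 0), b ∈ (4/5, 1], and
τ_n = Σ_{k=1}^n α_k(1 − α_k), the series Σ_{k=1}^∞ |α_k − α_{k+1}| τ_k converges. -/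
theorem sum_alpha_diff_tau_summable (b : ℝ) (hb : 4/5 < b ∧ b ≤ 1) (α τ : ℕ → ℝ)
    (hα0 : α 0 = 0)
    (hα : ∀ n ≥ 1, α n = 1 / ((n : ℝ) + 1) ^ b)
    (hτ : ∀ n, τ n = ∑ k ∈ Finset.Icc 1 n, α k * (1 - α k)) :
    Summable (fun k => |α k - α (k + 1)| * τ k) := by
  obtain ⟨hb1, hb2⟩ := hb
  have hpos : ∀ n, 0 ≤ α n := by
    intro n
    rcases Nat.eq_zero_or_pos n with h | h
    · rw [h, hα0]
    · rw [hα n h]; positivity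
  have hle : ∀ n, α n ≤ 1 := by
    intro n
    rcases Nat.eq_zero_or_pos n with h | h
    · rw [h, hα0]; norm_num
    · rw [hα n h]
      have : (1:ℝ) ≤ ((n : ℝ) + 1) ^ b :=
        Real.one_le_rpow (by have := Nat.cast_nonneg (α := ℝ) n; linarith) (by linarith)
      rw [div_le_one (by linarith)]; exact this
  have hτ0 : τ 0 = 0 := by rw [hτ]; simp
  have hτs : ∀ n, τ (n + 1) = τ n + α (n + 1) * (1 - α (n + 1)) := by
    intro n
    rw [hτ, hτ, Finset.sum_Icc_succ_top (by omega)]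
  have hτpos : ∀ n, 0 ≤ τ n := by
    intro n
    rw [hτ]
    exact Finset.sum_nonneg fun k _ => mul_nonneg (hpos k) (by linarith [hle k])
  have hdec : ∀ n ≥ 1, α (n + 1) ≤ α n := by
    intro n hn
    rw [hα n hn, hα (n + 1) (by omega)]
    apply one_div_le_one_div_of_le (by positivity)
    apply Real.rpow_le_rpow (by positivity) _ (by linarith)
    push_cast; linarith
  have hg : Summable (fun k => α k ^ 2) := by
    rw [← summable_nat_add_iff 1]
    have h1 : Summable (fun k : ℕ => 1 / (k : ℝ) ^ (2 * b)) :=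
      Real.summable_one_div_nat_rpow.2 (by linarith)
    refine ((summable_nat_add_iff 2).2 h1).congr fun k => ?_
    rw [hα (k + 1) (by omega), div_pow, one_pow, ← Real.rpow_natCast, ← Real.rpow_mul (by positivity)]
    push_cast
    congr 2 <;> ring
  have key : ∀ n, ∑ k ∈ Finset.range n, |α k - α (k + 1)| * τ k + α n * τ n
      ≤ ∑ k ∈ Finset.range (n + 1), α k ^ 2 := by
    intro n
    induction n with
    | zero => simp [hα0]
    | succ n ih =>
      rw [Finset.sum_range_succ, Finset.sum_range_succ _ (n + 1), hτs]
      have h1 : |α n - α (n + 1)| * τ n = (α n - α (n + 1)) * τ n := by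
        rcases Nat.eq_zero_or_pos n with h | h
        · rw [h, hτ0]; simp
        · rw [abs_of_nonneg (by linarith [hdec n h])]
      rw [h1]
      have : 0 ≤ α (n + 1) ^ 3 := pow_nonneg (hpos _) 3
      nlinarith
  refine summable_of_sum_range_le (c := ∑' k, α k ^ 2)
    (fun k => mul_nonneg (abs_nonneg _) (hτpos k)) fun n => ?_
  have h1 := key n
  have h2 := hg.sum_le_tsum (Finset.range (n + 1)) fun k _ => sq_nonneg (α k)
  have h3 := mul_nonneg (hpos n) (hτpos n)
  linarith
end

section
/- Let b ∈ (4/5, 1], α_n = 1/(n+1)^b, and τ_n = Σ_{k=1}^n α_k(1 − α_k). Then sup_n Σ_{k=1}^n α_k² (Σ_{j=1}^{k−1} α_j τ_j) < ∞, i.e., the series Σ_{k=1}^∞ α_k² Σ_{j=1}^{k−1} α_j τ_j converges. -/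
/-- With α_n = 1/(n+1)^b (α_0 = 0), b ∈ (4/5, 1], and
τ_n = Σ_{k=1}^n α_k(1 − α_k), the series Σ_{k=1}^∞ α_k² (Σ_{j=1}^{k−1} α_j τ_j) converges. -/
theorem sum_alpha_sq_inner_summable (b : ℝ) (hb : 4/5 < b ∧ b ≤ 1) (α τ : ℕ → ℝ)
    (hα0 : α 0 = 0)
    (hα : ∀ n ≥ 1, α n = 1 / ((n : ℝ) + 1) ^ b)
    (hτ : ∀ n, τ n = ∑ k ∈ Finset.Icc 1 n, α k * (1 - α k)) :
    Summable (fun k => α k ^ 2 * ∑ j ∈ Finset.Icc 1 (k - 1), α j * τ j) := by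
  obtain ⟨x, hx⟩ : ∃ x : ℕ → ℝ, ∀ k, x k = ((k : ℝ) + 1) ^ (1/5 : ℝ) := ⟨_, fun _ => rfl⟩
  have hx0 : ∀ k, 0 < x k := fun k => by rw [hx]; positivity
  have hxm : Monotone x := by
    intro m n h
    rw [hx, hx]
    gcongr
  have hx5 : ∀ k, x k ^ 5 = (k : ℝ) + 1 := by
    intro k
    rw [hx, ← Real.rpow_natCast, ← Real.rpow_mul (by positivity)]
    norm_num
  have hx4 : ∀ k, x k ^ 4 = ((k : ℝ) + 1) ^ (4/5 : ℝ) := by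
    intro k
    rw [hx, ← Real.rpow_natCast, ← Real.rpow_mul (by positivity)]
    norm_num
  have hx6 : ∀ k, x k ^ 6 = ((k : ℝ) + 1) ^ (6/5 : ℝ) := by
    intro k
    rw [hx, ← Real.rpow_natCast, ← Real.rpow_mul (by positivity)]
    norm_num
  have hnn : ∀ k, 0 ≤ α k := by
    intro k
    rcases Nat.eq_zero_or_pos k with rfl | h
    · rw [hα0]
    · rw [hα k h]; positivity
  have hle : ∀ k, α k ≤ 1 / x k ^ 4 := by
    intro k
    rcases Nat.eq_zero_or_pos k with rfl | h
    · rw [hα0]; have := hx0 0; positivity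
    · rw [hα k h, hx4]
      apply one_div_le_one_div_of_le (by positivity)
      apply Real.rpow_le_rpow_of_exponent_le _ hb.1.le
      have : (0:ℝ) ≤ k := by positivity
      linarith
  have hle1 : ∀ k, α k ≤ 1 := by
    intro k
    refine (hle k).trans ?_
    rw [div_le_one (by have := hx0 k; positivity), hx4]
    apply Real.one_le_rpow _ (by norm_num)
    have : (0:ℝ) ≤ k := by positivity
    linarith
  have hsum : ∀ n, ∑ k ∈ Finset.Icc 1 n, α k ≤ 5 * x n := by
    intro n
    induction n with
    | zero => have := hx0 0; simp; linarith
    | succ m ih =>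
      rw [Finset.sum_Icc_succ_top (by omega)]
      have h1 := hle (m+1)
      have hp := hx0 (m+1)
      have hq := hx0 m
      have hpq : x m ≤ x (m+1) := hxm (Nat.le_succ m)
      have h5 := hx5 (m+1)
      have h5' := hx5 m
      push_cast at h5
      have : 1 / x (m+1) ^ 4 ≤ 5 * (x (m+1) - x m) := by
        rw [div_le_iff₀ (by positivity)]
        generalize x (m+1) = p at *
        generalize x m = q at *
        have e : 1 = (p - q) * (p^4 + p^3*q + p^2*q^2 + p*q^3 + q^4) := by
          linear_combination h5' - h5
        have a1 : p^3*q ≤ p^3*p := by gcongr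
        have a2 : p^2*q^2 ≤ p^2*p^2 := by gcongr
        have a3 : p*q^3 ≤ p*p^3 := by gcongr
        have a4 : q^4 ≤ p^4 := by gcongr
        have : (p - q) * (p^4 + p^3*q + p^2*q^2 + p*q^3 + q^4) ≤ (p-q) * (5 * p^4) :=
          mul_le_mul_of_nonneg_left (by nlinarith) (by linarith)
        linarith
      linarith
  have hτ0 : ∀ n, 0 ≤ τ n := by
    intro n
    rw [hτ]
    exact Finset.sum_nonneg fun k _ => mul_nonneg (hnn k) (by linarith [hle1 k])
  have hτ1 : ∀ n, τ n ≤ 5 * x n := by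
    intro n
    rw [hτ]
    refine le_trans (Finset.sum_le_sum fun k _ => ?_) (hsum n)
    nlinarith [hnn k]
  have hS0 : ∀ k, 0 ≤ ∑ j ∈ Finset.Icc 1 (k - 1), α j * τ j := fun k =>
    Finset.sum_nonneg fun j _ => mul_nonneg (hnn j) (hτ0 j)
  have hS : ∀ k, ∑ j ∈ Finset.Icc 1 (k - 1), α j * τ j ≤ 25 * x k ^ 2 := by
    intro k
    have hk := hx0 k
    calc _ ≤ ∑ j ∈ Finset.Icc 1 (k - 1), α j * (5 * x k) := by
            refine Finset.sum_le_sum fun j hj => mul_le_mul_of_nonneg_left ?_ (hnn j)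
            have hjk : j ≤ k := by rw [Finset.mem_Icc] at hj; omega
            linarith [hτ1 j, hxm hjk]
      _ = (∑ j ∈ Finset.Icc 1 (k - 1), α j) * (5 * x k) := by rw [Finset.sum_mul]
      _ ≤ (5 * x k) * (5 * x k) := by
            refine mul_le_mul_of_nonneg_right ?_ (by positivity)
            linarith [hsum (k-1), hxm (Nat.sub_le k 1)]
      _ = _ := by ring
  have hs : Summable (fun k : ℕ => 25 * (1 / ((k : ℝ) + 1) ^ (6/5 : ℝ))) := by
    have h := (summable_nat_add_iff 1).2 (Real.summable_one_div_nat_rpow.2 (by norm_num : (1:ℝ) < 6/5))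
    push_cast at h
    exact h.mul_left 25
  refine Summable.of_nonneg_of_le (fun k => mul_nonneg (sq_nonneg _) (hS0 k)) (fun k => ?_) hs
  have hk := hx0 k
  calc _ ≤ (1 / x k ^ 4) ^ 2 * (25 * x k ^ 2) :=
        mul_le_mul (pow_le_pow_left₀ (hnn k) (hle k) 2) (hS k) (hS0 k) (by positivity)
    _ = _ := by rw [← hx6]; field_simp
end

section
/- Let b ∈ (4/5, 1], α_n = 1/(n+1)^b with α_0 = 0, τ_n = Σ_{k=1}^n α_k(1 − α_k) with τ_0 = 0, and α_{k,n} = α_k ∏_{j=k+1}^n (1 − α_j). Then sup_n Σ_{k=1}^n α_k √(Σ_{j=1}^{k−1} α_{j,k−1}² τ_{j−1}²) < ∞, i.e., the series Σ_{k=1}^∞ α_k √(Σ_{j=1}^{k−1} α_{j,k−1}² τ_{j−1}²) converges. -/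
lemma aux_bern (p m : ℝ) (hp0 : 0 ≤ p) (hp1 : p ≤ 1) (hm : 1 ≤ m) :
    (m - 1) ^ p + p * m ^ (p - 1) ≤ m ^ p := by
  have hm0 : 0 < m := by linarith
  have h := rpow_one_add_le_one_add_mul_self (s := -(1 / m)) (p := p)
    (by rw [neg_le_neg_iff, div_le_one hm0]; exact hm) hp0 hp1
  have e : m - 1 = m * (1 + -(1 / m)) := by field_simp; ring
  have hn : 0 ≤ 1 + -(1 / m) := by
    have : 1 / m ≤ 1 := by rw [div_le_one hm0]; exact hm
    linarith
  rw [e, Real.mul_rpow hm0.le hn, Real.rpow_sub_one hm0.ne']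
  have := mul_le_mul_of_nonneg_left h (Real.rpow_nonneg hm0.le p)
  calc _ ≤ m ^ p * (1 + p * -(1 / m)) + p * (m ^ p / m) := by linarith
    _ = m ^ p := by field_simp; ring

lemma aux_shift (c m : ℝ) (hc1 : c ≤ 1) (hm : 1 < m) :
    (1 - 1 / m) * (m - 1) ^ (-c) ≤ m ^ (-c) := by
  have hm0 : 0 < m := by linarith
  have hm1 : 0 < m - 1 := by linarith
  have e1 : (m - 1) ^ (-c) * (m - 1) = (m - 1) ^ (1 - c) := by
    rw [← Real.rpow_add_one hm1.ne']; ring_nf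
  have e2 : m ^ (-c) * m = m ^ (1 - c) := by
    rw [← Real.rpow_add_one hm0.ne']; ring_nf
  have h : (m - 1) ^ (1 - c) ≤ m ^ (1 - c) :=
    Real.rpow_le_rpow hm1.le (by linarith) (by linarith)
  rw [← e1, ← e2] at h
  have e3 : (1 - 1 / m) * (m - 1) ^ (-c) = ((m - 1) ^ (-c) * (m - 1)) / m := by
    field_simp
  rw [e3, div_le_iff₀ hm0]
  exact h

/-- With α_n = 1/(n+1)^b (α_0 = 0), b ∈ (4/5, 1],
τ_n = Σ_{k=1}^n α_k(1 − α_k) (τ_0 = 0), and α_{k,n} = α_k ∏_{j=k+1}^n (1 − α_j),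
the series Σ_{k=1}^∞ α_k √(Σ_{j=1}^{k−1} α_{j,k−1}² τ_{j−1}²) converges. -/
theorem sum_alpha_sqrt_summable (b : ℝ) (hb : 4/5 < b ∧ b ≤ 1) (α τ : ℕ → ℝ)
    (αp : ℕ → ℕ → ℝ)
    (hα0 : α 0 = 0)
    (hα : ∀ n ≥ 1, α n = 1 / ((n : ℝ) + 1) ^ b)
    (hτ : ∀ n, τ n = ∑ k ∈ Finset.Icc 1 n, α k * (1 - α k))
    (hαp : ∀ k n, αp k n = α k * ∏ j ∈ Finset.Icc (k + 1) n, (1 - α j)) :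
    Summable (fun k =>
      α k * Real.sqrt (∑ j ∈ Finset.Icc 1 (k - 1), (αp j (k - 1)) ^ 2 * (τ (j - 1)) ^ 2)) := by
  obtain ⟨hb0, hb1⟩ := hb
  have hα' : ∀ n : ℕ, α (n + 1) = ((n : ℝ) + 2) ^ (-b) := by
    intro n
    rw [hα (n + 1) (by omega), Real.rpow_neg (by positivity)]
    push_cast
    rw [one_div]
    ring_nf
  have hpos : ∀ n : ℕ, 0 < α (n + 1) := by
    intro n; rw [hα']; positivity
  have hle1 : ∀ n : ℕ, α (n + 1) ≤ 1 := by
    intro n; rw [hα']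
    exact Real.rpow_le_one_of_one_le_of_nonpos (by linarith [Nat.cast_nonneg (α := ℝ) n])
      (by linarith)
  have hτs : ∀ n, τ (n + 1) = τ n + α (n + 1) * (1 - α (n + 1)) := by
    intro n
    rw [hτ, hτ, Finset.sum_Icc_succ_top (by omega)]
  have hτ0 : τ 0 = 0 := by rw [hτ]; simp
  have hτb : ∀ n : ℕ, 0 ≤ τ n ∧ τ n ≤ (4 / b) * ((n : ℝ) + 1) ^ (b / 4) := by
    intro n
    induction n with
    | zero => rw [hτ0]; exact ⟨le_rfl, by positivity⟩
    | succ n ih =>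
      obtain ⟨i1, i2⟩ := ih
      have h1 := hpos n
      have h2 := hle1 n
      rw [hτs]
      refine ⟨by nlinarith, ?_⟩
      have h3 : α (n + 1) ≤ ((n : ℝ) + 2) ^ (b / 4 - 1) := by
        rw [hα']
        exact Real.rpow_le_rpow_of_exponent_le (by linarith [Nat.cast_nonneg (α := ℝ) n])
          (by linarith)
      have h4 := aux_bern (b / 4) ((n : ℝ) + 2) (by linarith) (by linarith)
        (by linarith [Nat.cast_nonneg (α := ℝ) n])
      have e1 : (n : ℝ) + 2 - 1 = n + 1 := by ring
      have e2 : ((n + 1 : ℕ) : ℝ) + 1 = n + 2 := by push_cast; ring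
      rw [e1] at h4
      rw [e2]
      have h5 := mul_le_mul_of_nonneg_left h4 (show 0 ≤ 4 / b by positivity)
      have e3 : 4 / b * (((n : ℝ) + 1) ^ (b / 4) + b / 4 * ((n : ℝ) + 2) ^ (b / 4 - 1))
        = 4 / b * ((n : ℝ) + 1) ^ (b / 4) + ((n : ℝ) + 2) ^ (b / 4 - 1) := by
        field_simp
      rw [e3] at h5
      nlinarith
  set S : ℕ → ℝ := fun n => ∑ j ∈ Finset.Icc 1 n, (αp j n) ^ 2 * (τ (j - 1)) ^ 2 with hS
  have hSs : ∀ n, S (n + 1) = (1 - α (n + 1)) ^ 2 * S n + α (n + 1) ^ 2 * τ n ^ 2 := by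
    intro n
    simp only [hS]
    rw [Finset.sum_Icc_succ_top (by omega), Finset.mul_sum]
    congr 1
    · refine Finset.sum_congr rfl fun j hj => ?_
      rw [Finset.mem_Icc] at hj
      rw [hαp, hαp, Finset.prod_Icc_succ_top (by omega)]
      ring
    · rw [hαp]; simp
  have hS0 : ∀ n, 0 ≤ S n := fun n => Finset.sum_nonneg fun j _ => by positivity
  have hSb : ∀ n : ℕ, S n ≤ (4 / b) ^ 2 * ((n : ℝ) + 1) ^ (-(b / 2)) := by
    intro n
    induction n with
    | zero => simp only [hS]; simp; positivity
    | succ n ih =>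
      have hn := Nat.cast_nonneg (α := ℝ) n
      have h1 := hpos n
      have h2 := hle1 n
      obtain ⟨t0, t1⟩ := hτb n
      have e1 : (n : ℝ) + 2 - 1 = n + 1 := by ring
      have e2 : ((n + 1 : ℕ) : ℝ) + 1 = n + 2 := by push_cast; ring
      rw [hSs, e2]
      have h3 := aux_shift (b / 2) ((n : ℝ) + 2) (by linarith) (by linarith)
      rw [e1] at h3
      have h4 : 1 / ((n : ℝ) + 2) ≤ α (n + 1) := by
        rw [hα', one_div, ← Real.rpow_neg_one]
        exact Real.rpow_le_rpow_of_exponent_le (by linarith) (by linarith)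
      have hK : 0 ≤ (4 / b) ^ 2 := by positivity
      have t2 : τ n ^ 2 ≤ (4 / b) ^ 2 * ((n : ℝ) + 2) ^ (b / 2) := by
        have : ((n : ℝ) + 1) ^ (b / 4) ≤ ((n : ℝ) + 2) ^ (b / 4) :=
          Real.rpow_le_rpow (by linarith) (by linarith) (by linarith)
        have t3 : τ n ≤ (4 / b) * ((n : ℝ) + 2) ^ (b / 4) :=
          t1.trans (mul_le_mul_of_nonneg_left this (by positivity))
        have e : ((n : ℝ) + 2) ^ (b / 2) = (((n : ℝ) + 2) ^ (b / 4)) ^ 2 := by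
          rw [← Real.rpow_natCast, ← Real.rpow_mul (by linarith)]
          congr 1; push_cast; ring
        rw [e, ← mul_pow]
        exact pow_le_pow_left₀ t0 t3 2
      have e3 : α (n + 1) * ((n : ℝ) + 2) ^ (b / 2) = ((n : ℝ) + 2) ^ (-(b / 2)) := by
        rw [hα', ← Real.rpow_add (by linarith)]
        congr 1; ring
      set x := α (n + 1)
      set A := ((n : ℝ) + 1) ^ (-(b / 2))
      set B := ((n : ℝ) + 2) ^ (-(b / 2))
      have hA : 0 ≤ A := by positivity
      have h5 : (1 - x) * A ≤ B :=
        (mul_le_mul_of_nonneg_right (by linarith) hA).trans h3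
      have hx : 0 ≤ 1 - x := by linarith
      calc (1 - x) ^ 2 * S n + x ^ 2 * τ n ^ 2
          ≤ (1 - x) ^ 2 * ((4 / b) ^ 2 * A)
            + x ^ 2 * ((4 / b) ^ 2 * ((n : ℝ) + 2) ^ (b / 2)) := by gcongr
        _ = (4 / b) ^ 2 * ((1 - x) * ((1 - x) * A))
            + x * ((4 / b) ^ 2 * (x * ((n : ℝ) + 2) ^ (b / 2))) := by ring
        _ = (4 / b) ^ 2 * ((1 - x) * ((1 - x) * A)) + x * ((4 / b) ^ 2 * B) := by rw [e3]
        _ ≤ (4 / b) ^ 2 * ((1 - x) * B) + x * ((4 / b) ^ 2 * B) := by gcongr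
        _ = (4 / b) ^ 2 * B := by ring
  rw [← summable_nat_add_iff 1]
  have hsum : Summable (fun k : ℕ => (4 / b) * ((k + 1 : ℕ) : ℝ) ^ (-(5 * b / 4))) := by
    apply Summable.mul_left
    rw [summable_nat_add_iff (f := fun k : ℕ => (k : ℝ) ^ (-(5 * b / 4))) 1]
    exact Real.summable_nat_rpow.2 (by linarith)
  refine Summable.of_nonneg_of_le (fun k => mul_nonneg (hpos k).le (Real.sqrt_nonneg _))
    (fun k => ?_) hsum
  have hk := Nat.cast_nonneg (α := ℝ) k
  change α (k + 1) * Real.sqrt (S k) ≤ _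
  have h1 : Real.sqrt (S k) ≤ (4 / b) * ((k : ℝ) + 1) ^ (-(b / 4)) := by
    apply Real.sqrt_le_iff.2 ⟨by positivity, ?_⟩
    refine (hSb k).trans (le_of_eq ?_)
    rw [mul_pow, ← Real.rpow_natCast (((k : ℝ) + 1) ^ (-(b / 4))), ← Real.rpow_mul (by linarith)]
    congr 2; push_cast; ring
  have h2 : α (k + 1) ≤ ((k : ℝ) + 1) ^ (-b) := by
    rw [hα']
    exact Real.rpow_le_rpow_of_nonpos (by linarith) (by linarith) (by linarith)
  calc α (k + 1) * Real.sqrt (S k)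
      ≤ ((k : ℝ) + 1) ^ (-b) * ((4 / b) * ((k : ℝ) + 1) ^ (-(b / 4))) := by gcongr
    _ = (4 / b) * (((k : ℝ) + 1) ^ (-b) * ((k : ℝ) + 1) ^ (-(b / 4))) := by ring
    _ = (4 / b) * ((k + 1 : ℕ) : ℝ) ^ (-(5 * b / 4)) := by
      rw [← Real.rpow_add (by linarith)]
      push_cast
      congr 2; ring
end

section
/- Let b ∈ (4/5, 1], α_n = 1/(n+1)^b with α_0 = 0, and α_{k,n} = α_k ∏_{j=k+1}^n (1 − α_j). Let {c_n}_{n≥1} be nonnegative reals with c_n² ≤ C/n for all n ≥ 1 and some constant C > 0 (so c_n ≤ √C/√n). Then: (i) Σ_{k=1}^∞ α_k c_k < ∞; (ii) Σ_{k=1}^∞ α_k c_k² < ∞; (iii) Σ_{k=1}^∞ α_k² c_k² < ∞; and (iv) sup_n Σ_{k=1}^n α_k (Σ_{j=1}^{k−1} α_{j,k−1} c_j) < ∞. -/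
/-- With α_n = 1/(n+1)^b (α_0 = 0), b ∈ (4/5, 1],
α_{k,n} = α_k ∏_{j=k+1}^n (1 − α_j), and c_n ≥ 0 with c_n² ≤ C/n (C > 0):
(i) Σ α_k c_k < ∞; (ii) Σ α_k c_k² < ∞; (iii) Σ α_k² c_k² < ∞;
(iv) sup_n Σ_{k=1}^n α_k (Σ_{j=1}^{k−1} α_{j,k−1} c_j) < ∞. -/
theorem additive_noise_sums (b : ℝ) (hb : 4/5 < b ∧ b ≤ 1) (α : ℕ → ℝ)
    (αp : ℕ → ℕ → ℝ)
    (hα0 : α 0 = 0)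
    (hα : ∀ n ≥ 1, α n = 1 / ((n : ℝ) + 1) ^ b)
    (hαp : ∀ k n, αp k n = α k * ∏ j ∈ Finset.Icc (k + 1) n, (1 - α j))
    (c : ℕ → ℝ) (hc0 : ∀ n, 0 ≤ c n)
    (C : ℝ) (hC : 0 < C) (hc : ∀ n ≥ 1, c n ^ 2 ≤ C / n) :
    Summable (fun k => α k * c k) ∧
    Summable (fun k => α k * c k ^ 2) ∧
    Summable (fun k => α k ^ 2 * c k ^ 2) ∧
    ∃ B : ℝ, ∀ n, ∑ k ∈ Finset.Icc 1 n, α k * (∑ j ∈ Finset.Icc 1 (k - 1), αp j (k - 1) * c j) ≤ B := by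
  obtain ⟨hb1, hb2⟩ := hb
  have hb0 : 0 ≤ b := by linarith
  have a0 : ∀ n, 0 ≤ α n := by
    intro n
    rcases Nat.eq_zero_or_pos n with h | h
    · rw [h, hα0]
    · rw [hα n h]; positivity
  have a1 : ∀ n, α n ≤ 1 := by
    intro n
    rcases Nat.eq_zero_or_pos n with h | h
    · rw [h, hα0]; norm_num
    · rw [hα n h]
      have : (1:ℝ) ≤ ((n:ℝ)+1)^b := Real.one_le_rpow (by
        have : (0:ℝ) ≤ n := Nat.cast_nonneg n
        linarith) hb0
      rw [div_le_one (by linarith)]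
      exact this
  have a2 : ∀ n ≥ 1, α n ≤ 1 / (n:ℝ)^b := by
    intro n hn
    have h : (0:ℝ) < n := by exact_mod_cast hn
    rw [hα n hn]
    apply one_div_le_one_div_of_le (by positivity)
    exact Real.rpow_le_rpow h.le (by linarith) hb0
  have c2 : ∀ n ≥ 1, c n ≤ Real.sqrt C * (1 / (n:ℝ)^(1/2:ℝ)) := by
    intro n hn
    have := Real.le_sqrt_of_sq_le (hc n hn)
    rw [Real.sqrt_div hC.le, Real.sqrt_eq_rpow (n:ℝ)] at this
    rw [mul_one_div]; exact this
  have S1 : Summable (fun k => α k * c k) := by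
    refine Summable.of_nonneg_of_le (fun k => mul_nonneg (a0 k) (hc0 k)) (fun k => ?_)
      ((Real.summable_one_div_nat_rpow (p := b + 1/2)).2 (by linarith) |>.mul_left (Real.sqrt C))
    rcases Nat.eq_zero_or_pos k with h | h
    · rw [h, hα0, zero_mul]; positivity
    · have hk : (0:ℝ) < k := by exact_mod_cast h
      calc α k * c k ≤ (1 / (k:ℝ)^b) * (Real.sqrt C * (1 / (k:ℝ)^(1/2:ℝ))) :=
            mul_le_mul (a2 k h) (c2 k h) (hc0 k) (by positivity)
        _ = _ := by rw [Real.rpow_add hk]; field_simp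
  have S2 : Summable (fun k => α k * c k ^ 2) := by
    refine Summable.of_nonneg_of_le (fun k => mul_nonneg (a0 k) (sq_nonneg _)) (fun k => ?_)
      ((Real.summable_one_div_nat_rpow (p := b + 1)).2 (by linarith) |>.mul_left C)
    rcases Nat.eq_zero_or_pos k with h | h
    · rw [h, hα0, zero_mul]; positivity
    · have hk : (0:ℝ) < k := by exact_mod_cast h
      calc α k * c k ^ 2 ≤ (1 / (k:ℝ)^b) * (C / k) :=
            mul_le_mul (a2 k h) (hc k h) (sq_nonneg _) (by positivity)
        _ = _ := by rw [Real.rpow_add hk, Real.rpow_one]; field_simp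
  refine ⟨S1, S2, ?_, ∑' k, α k * c k, ?_⟩
  · refine Summable.of_nonneg_of_le (fun k => by positivity) (fun k => ?_) S2
    exact mul_le_mul_of_nonneg_right (by nlinarith [a0 k, a1 k]) (sq_nonneg _)
  · have rec1 : ∀ n, ∑ j ∈ Finset.Icc 1 (n+1), αp j (n+1) * c j
        = (1 - α (n+1)) * (∑ j ∈ Finset.Icc 1 n, αp j n * c j) + α (n+1) * c (n+1) := by
      intro n
      rw [Finset.sum_Icc_succ_top (by omega), Finset.mul_sum]
      congr 1
      · refine Finset.sum_congr rfl fun j hj => ?_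
        have := (Finset.mem_Icc.1 hj).2
        rw [hαp, hαp, Finset.prod_Icc_succ_top (by omega)]
        ring
      · rw [hαp, Finset.Icc_eq_empty (by omega)]; simp
    have key : ∀ n, ∑ k ∈ Finset.Icc 1 n, α k * (∑ j ∈ Finset.Icc 1 (k - 1), αp j (k - 1) * c j)
        = ∑ k ∈ Finset.Icc 1 n, α k * c k - ∑ j ∈ Finset.Icc 1 n, αp j n * c j := by
      intro n
      induction n with
      | zero => simp
      | succ n ih =>
        rw [rec1, Finset.sum_Icc_succ_top (by omega), ih, Finset.sum_Icc_succ_top (by omega),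
          Nat.add_sub_cancel]
        ring
    intro n
    rw [key]
    have h1 : ∑ k ∈ Finset.Icc 1 n, α k * c k ≤ ∑' k, α k * c k :=
      S1.sum_le_tsum _ (fun k _ => mul_nonneg (a0 k) (hc0 k))
    have h2 : 0 ≤ ∑ j ∈ Finset.Icc 1 n, αp j n * c j := by
      refine Finset.sum_nonneg fun j _ => mul_nonneg ?_ (hc0 j)
      rw [hαp]
      exact mul_nonneg (a0 j) (Finset.prod_nonneg fun i _ => by linarith [a1 i])
    linarith
end

section
/- Let b ∈ (4/5, 1], α_n = 1/(n+1)^b with α_0 = 0, τ_n = Σ_{k=1}^n α_k(1 − α_k), and α_{k,n} = α_k ∏_{j=k+1}^n (1 − α_j). Let ‖·‖ be a norm on ℝ^d, fix n ≥ 1, let ζ ≥ 0, and let ν_0, ν_1, …, ν_n ∈ ℝ^d satisfy ‖ν_k‖ ≤ ζ τ_n for all 0 ≤ k ≤ n. Then ‖Σ_{k=1}^n α_{k,n} (ν_{k−1} − ν_k)‖ ≤ 2 ζ α_n τ_n. -/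
/-- Abel-summation estimate.  With α_n = 1/(n+1)^b (α_0 = 0),
b ∈ (4/5, 1], τ_n = Σ_{k=1}^n α_k(1 − α_k), α_{k,n} = α_k ∏_{j=k+1}^n (1 − α_j),
if ‖ν_k‖ ≤ ζ τ_n for 0 ≤ k ≤ n (n ≥ 1, ζ ≥ 0), then
‖Σ_{k=1}^n α_{k,n}(ν_{k−1} − ν_k)‖ ≤ 2 ζ α_n τ_n. -/
theorem abel_summation_noise_bound {E : Type*} [NormedAddCommGroup E] [NormedSpace ℝ E]
    (b : ℝ) (hb : 4/5 < b ∧ b ≤ 1)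
    (α τ : ℕ → ℝ) (αp : ℕ → ℕ → ℝ) (hα0 : α 0 = 0)
    (hα : ∀ n ≥ 1, α n = 1 / ((n : ℝ) + 1) ^ b)
    (hτ : ∀ n, τ n = ∑ k ∈ Finset.Icc 1 n, α k * (1 - α k))
    (hαp : ∀ k n, αp k n = α k * ∏ j ∈ Finset.Icc (k + 1) n, (1 - α j))
    (n : ℕ) (hn : 1 ≤ n) (ζ : ℝ) (hζ : 0 ≤ ζ)
    (ν : ℕ → E) (hν : ∀ k ≤ n, ‖ν k‖ ≤ ζ * τ n) :
    ‖∑ k ∈ Finset.Icc 1 n, αp k n • (ν (k - 1) - ν k)‖ ≤ 2 * ζ * α n * τ n := by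
  have hrec : ∀ m, 0 ≤ α (m+1) ∧ α (m+1) ≤ 1 ∧ (1 - α (m+1)) * α m ≤ α (m+1) := by
    intro m
    have hB1 : (1:ℝ) ≤ ((m:ℝ) + 1 + 1) ^ b :=
      Real.one_le_rpow (by linarith [(Nat.cast_nonneg m : (0:ℝ) ≤ m)]) (by linarith [hb.1])
    have e : α (m+1) = 1 / ((m:ℝ) + 1 + 1) ^ b := by
      rw [hα (m+1) (by omega)]; push_cast; rfl
    have h0 : 0 ≤ α (m+1) := by rw [e]; positivity
    refine ⟨h0, ?_, ?_⟩
    · rw [e, div_le_one (by linarith)]; exact hB1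
    · rcases Nat.eq_zero_or_pos m with h | h
      · subst h; rw [hα0]; simpa using h0
      · have hAB : ((m:ℝ) + 1 + 1) ^ b ≤ ((m:ℝ) + 1) ^ b + 1 := by
          have := Real.rpow_add_le_add_rpow (show (0:ℝ) ≤ (m:ℝ)+1 by positivity)
            (zero_le_one) (by linarith [hb.1] : 0 ≤ b) hb.2
          simpa using this
        have hA : 0 < ((m:ℝ) + 1) ^ b := by positivity
        rw [e, hα m h]
        generalize ((m:ℝ) + 1 + 1) ^ b = B at *
        generalize ((m:ℝ) + 1) ^ b = A at *
        have hB : 0 < B := by linarith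
        have : (1 - 1 / B) * (1 / A) = ((B - 1) / A) * (1 / B) := by field_simp
        rw [this]
        have h2 : (B - 1) / A ≤ 1 := by rw [div_le_one hA]; linarith
        have h3 : 0 ≤ 1 / B := by positivity
        nlinarith
  have hα_nn : ∀ m, 0 ≤ α m := by
    intro m
    cases m with
    | zero => exact hα0.ge
    | succ m => exact (hrec m).1
  have hS : ∀ m, ∑ k ∈ Finset.Icc 1 (m+1), αp k (m+1) • (ν (k - 1) - ν k)
      = (1 - α (m+1)) • ∑ k ∈ Finset.Icc 1 m, αp k m • (ν (k - 1) - ν k)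
        + α (m+1) • (ν m - ν (m+1)) := by
    intro m
    rw [Finset.sum_Icc_succ_top (by omega), Finset.smul_sum]
    congr 1
    · refine Finset.sum_congr rfl fun k hk => ?_
      rw [Finset.mem_Icc] at hk
      rw [smul_smul, hαp, hαp, Finset.prod_Icc_succ_top (by omega)]
      congr 1
      ring
    · rw [hαp]; simp
  have key : ∀ m ≤ n, ‖(∑ k ∈ Finset.Icc 1 m, αp k m • (ν (k - 1) - ν k)) + α m • ν m‖
      ≤ α m * (ζ * τ n) := by
    intro m
    induction m with
    | zero => intro _; simp [hα0]
    | succ m ih =>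
      intro hm
      have ih := ih (by omega)
      obtain ⟨h0, h1, h2⟩ := hrec m
      rw [hS]
      generalize (∑ k ∈ Finset.Icc 1 m, αp k m • (ν (k - 1) - ν k)) = S at *
      have e : (1 - α (m+1)) • S + α (m+1) • (ν m - ν (m+1)) + α (m+1) • ν (m+1)
          = (1 - α (m+1)) • (S + α m • ν m)
            + (α (m+1) - (1 - α (m+1)) * α m) • ν m := by module
      rw [e]
      refine (norm_add_le _ _).trans ?_
      rw [norm_smul, norm_smul, Real.norm_of_nonneg (by linarith),
        Real.norm_of_nonneg (by linarith)]
      have a1 := mul_le_mul_of_nonneg_left ih (show 0 ≤ 1 - α (m+1) by linarith)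
      have a2 := mul_le_mul_of_nonneg_left (hν m (by omega))
        (show 0 ≤ α (m+1) - (1 - α (m+1)) * α m by linarith)
      linarith
  have k1 := key n le_rfl
  generalize (∑ k ∈ Finset.Icc 1 n, αp k n • (ν (k - 1) - ν k)) = S at *
  have k2 : ‖S‖ ≤ ‖S + α n • ν n‖ + ‖α n • ν n‖ := by
    simpa using norm_sub_le (S + α n • ν n) (α n • ν n)
  rw [norm_smul (α n), Real.norm_of_nonneg (hα_nn n)] at k2
  have k3 := mul_le_mul_of_nonneg_left (hν n le_rfl) (hα_nn n)
  linarith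
end

section
/- Let b ∈ (4/5, 1], α_n = 1/(n+1)^b with α_0 = 0, τ_n = Σ_{k=1}^n α_k(1 − α_k), and α_{k,n} = α_k ∏_{j=k+1}^n (1 − α_j). Let C₁, C₂, C₃, C₄ ≥ 0 and let {c_n}_{n≥1} be nonnegative reals with c_n ≤ C₂/√n. Define ω_n = C₁ τ_n √(α_{n+1}) + Σ_{i=1}^n α_{i,n} c_i + C₃ α_n τ_n + C₄ α_n Σ_{i=1}^n α_i τ_i. Then there is a constant K such that ω_n ≤ K τ_n √(α_{n+1}) for all n ≥ 1, i.e., ω_n = O(τ_n √(α_{n+1})). -/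
/-- With α_n = 1/(n+1)^b (α_0 = 0), b ∈ (4/5, 1],
τ_n = Σ_{k=1}^n α_k(1 − α_k), α_{k,n} = α_k ∏_{j=k+1}^n (1 − α_j), constants
C₁, C₂, C₃, C₄ ≥ 0, and 0 ≤ c_n ≤ C₂/√n, the quantity
ω_n = C₁ τ_n √α_{n+1} + Σ_{i=1}^n α_{i,n} c_i + C₃ α_n τ_n + C₄ α_n Σ_{i=1}^n α_i τ_i
satisfies ω_n ≤ K τ_n √α_{n+1} for some constant K and all n ≥ 1. -/
theorem omega_order (b : ℝ) (hb : 4/5 < b ∧ b ≤ 1)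
    (α τ : ℕ → ℝ) (αp : ℕ → ℕ → ℝ) (hα0 : α 0 = 0)
    (hα : ∀ n ≥ 1, α n = 1 / ((n : ℝ) + 1) ^ b)
    (hτ : ∀ n, τ n = ∑ k ∈ Finset.Icc 1 n, α k * (1 - α k))
    (hαp : ∀ k n, αp k n = α k * ∏ j ∈ Finset.Icc (k + 1) n, (1 - α j))
    (C₁ C₂ C₃ C₄ : ℝ) (hC₁ : 0 ≤ C₁) (hC₂ : 0 ≤ C₂) (hC₃ : 0 ≤ C₃) (hC₄ : 0 ≤ C₄)
    (c : ℕ → ℝ) (hc0 : ∀ n, 0 ≤ c n)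
    (hc : ∀ n ≥ 1, c n ≤ C₂ / Real.sqrt n)
    (ω : ℕ → ℝ)
    (hω : ∀ n, ω n = C₁ * τ n * Real.sqrt (α (n + 1))
        + ∑ i ∈ Finset.Icc 1 n, αp i n * c i
        + C₃ * α n * τ n
        + C₄ * α n * ∑ i ∈ Finset.Icc 1 n, α i * τ i) :
    ∃ K : ℝ, ∀ n ≥ 1, ω n ≤ K * τ n * Real.sqrt (α (n + 1)) := by
  obtain ⟨hb1, hb2⟩ := hb
  have hαpos : ∀ n ≥ 1, 0 < α n := by
    intro n hn
    rw [hα n hn]; positivity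
  have hαlow : ∀ n : ℕ, n ≥ 1 → 1 / ((n : ℝ) + 1) ≤ α n := by
    intro n hn
    rw [hα n hn]
    apply one_div_le_one_div_of_le (by positivity)
    calc ((n : ℝ) + 1) ^ b ≤ ((n : ℝ) + 1) ^ (1 : ℝ) :=
          Real.rpow_le_rpow_of_exponent_le (by linarith [Nat.cast_nonneg (α := ℝ) n]) hb2
      _ = _ := Real.rpow_one _
  have hαlt : ∀ n ≥ 1, α n < 1 := by
    intro n hn
    rw [hα n hn, div_lt_one (by positivity)]
    apply Real.one_lt_rpow _ (by linarith)
    have : (1 : ℝ) ≤ n := by exact_mod_cast hn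
    linarith
  have hratio : ∀ n : ℕ, n ≥ 1 → α n * (1 - 1 / ((n : ℝ) + 2)) ≤ α (n + 1) := by
    intro n hn
    have hn0 : (0 : ℝ) ≤ n := Nat.cast_nonneg n
    rw [hα n hn, hα (n + 1) (by omega)]
    have h1 : (1 - 1 / ((n : ℝ) + 2)) = ((n : ℝ) + 1) / (n + 2) := by
      field_simp; ring
    have h2 : ((n : ℝ) + 1) / (n + 2) ≤ (((n : ℝ) + 1) / (n + 2)) ^ b := by
      calc ((n : ℝ) + 1) / (n + 2) = (((n : ℝ) + 1) / (n + 2)) ^ (1 : ℝ) := (Real.rpow_one _).symm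
        _ ≤ _ := Real.rpow_le_rpow_of_exponent_ge (by positivity)
            (by rw [div_le_one (by positivity)]; linarith) hb2
    rw [h1]
    rw [Real.div_rpow (by positivity) (by positivity)] at h2
    push_cast
    have h3 : (n : ℝ) + 1 + 1 = n + 2 := by ring
    rw [h3]
    calc 1 / ((n : ℝ) + 1) ^ b * (((n : ℝ) + 1) / (n + 2))
        ≤ 1 / ((n : ℝ) + 1) ^ b * (((n : ℝ) + 1) ^ b / (n + 2) ^ b) := by gcongr
      _ = _ := by
        have : ((n : ℝ) + 1) ^ b ≠ 0 := by positivity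
        field_simp
  have hsq : ∀ n ≥ 1, Real.sqrt (α n) ^ 2 = α n := fun n hn => Real.sq_sqrt (hαpos n hn).le
  have hrpos : ∀ n ≥ 1, 0 < Real.sqrt (α n) := fun n hn => Real.sqrt_pos.2 (hαpos n hn)
  have F1 : ∀ n ≥ 1, Real.sqrt (α n) * (1 - 2 / 3 * α n) ≤ Real.sqrt (α (n + 1)) := by
    intro n hn
    have hn0 : (1 : ℝ) ≤ n := by exact_mod_cast hn
    apply Real.le_sqrt_of_sq_le
    rw [mul_pow, hsq n hn]
    refine le_trans ?_ (hratio n hn)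
    apply mul_le_mul_of_nonneg_left _ (hαpos n hn).le
    have hu : 1 / ((n : ℝ) + 2) ≤ α n :=
      le_trans (one_div_le_one_div_of_le (by positivity) (by linarith)) (hαlow n hn)
    have hu3 : 1 / ((n : ℝ) + 2) ≤ 1 / 3 :=
      one_div_le_one_div_of_le (by positivity) (by linarith)
    have hu0 : 0 ≤ 1 / ((n : ℝ) + 2) := by positivity
    set u := 1 / ((n : ℝ) + 2)
    have h1 := hαlt n hn
    calc (1 - 2 / 3 * α n) ^ 2 ≤ (1 - 2 / 3 * u) ^ 2 := by
          apply pow_le_pow_left₀ <;> linarith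
      _ ≤ 1 - u := by nlinarith
  have F2 : ∀ n : ℕ, n ≥ 1 → 1 / Real.sqrt n ≤ 2 * Real.sqrt (α n) := by
    intro n hn
    have hn0 : (1 : ℝ) ≤ n := by exact_mod_cast hn
    have h1 : (1 / Real.sqrt n) = Real.sqrt (1 / n) := by simp
    have h2 : 2 * Real.sqrt (α n) = Real.sqrt (4 * α n) := by
      rw [Real.sqrt_mul (by norm_num)]
      have : Real.sqrt 4 = 2 := by
        rw [show (4 : ℝ) = 2 ^ 2 by norm_num]; exact Real.sqrt_sq (by norm_num)
      rw [this]
    rw [h1, h2]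
    apply Real.sqrt_le_sqrt
    have h3 := hαlow n hn
    have h4 : 1 / (n : ℝ) ≤ 4 * (1 / ((n : ℝ) + 1)) := by
      rw [mul_one_div, div_le_div_iff₀ (by positivity) (by positivity)]; linarith
    linarith
  have F3 : ∀ n ≥ 1, Real.sqrt (α n) ≤ 3 * Real.sqrt (α (n + 1)) := by
    intro n hn
    nlinarith [F1 n hn, hrpos n hn, hαlt n hn]
  have hr1 : ∀ n ≥ 1, Real.sqrt (α n) ≤ 1 := by
    intro n hn
    rw [Real.sqrt_le_one]; exact (hαlt n hn).le
  -- additive noise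
  have hs : ∀ n : ℕ, ∑ i ∈ Finset.Icc 1 n, αp i n * c i ≤ 6 * C₂ * Real.sqrt (α (n + 1)) := by
    intro n
    induction n with
    | zero => simp; positivity
    | succ n ih =>
      have hrec : ∑ i ∈ Finset.Icc 1 (n + 1), αp i (n + 1) * c i
          = (1 - α (n + 1)) * (∑ i ∈ Finset.Icc 1 n, αp i n * c i) + α (n + 1) * c (n + 1) := by
        rw [Finset.sum_Icc_succ_top (by omega), Finset.mul_sum]
        congr 1
        · apply Finset.sum_congr rfl
          intro i hi
          have := (Finset.mem_Icc.1 hi).2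
          rw [hαp, hαp, Finset.prod_Icc_succ_top (by omega)]
          ring
        · rw [hαp]; simp
      have hn : n + 1 ≥ 1 := by omega
      rw [hrec]
      have hcn : c (n + 1) ≤ C₂ * (2 * Real.sqrt (α (n + 1))) := by
        have h1 := hc (n + 1) hn
        rw [div_eq_mul_one_div] at h1
        exact h1.trans (mul_le_mul_of_nonneg_left (F2 (n + 1) hn) hC₂)
      have a1 := mul_le_mul_of_nonneg_left ih (by linarith [hαlt _ hn] : 0 ≤ 1 - α (n + 1))
      have a2 := mul_le_mul_of_nonneg_left hcn (hαpos _ hn).le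
      have a3 := mul_le_mul_of_nonneg_left (F1 _ hn) (by positivity : 0 ≤ 6 * C₂)
      linarith
  -- partial sums of the step sizes
  have ht1 : ∀ n : ℕ, 1 ≤ ((n : ℝ) + 1) ^ (1 / 5 : ℝ) := fun n =>
    Real.one_le_rpow (by linarith [Nat.cast_nonneg (α := ℝ) n]) (by norm_num)
  have ht5 : ∀ n : ℕ, (((n : ℝ) + 1) ^ (1 / 5 : ℝ)) ^ 5 = n + 1 := by
    intro n
    rw [← Real.rpow_natCast, ← Real.rpow_mul (by positivity)]
    norm_num
  have hα4 : ∀ n : ℕ, n ≥ 1 → α n * (((n : ℝ) + 1) ^ (1 / 5 : ℝ)) ^ 4 ≤ 1 := by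
    intro n hn
    rw [← Real.rpow_natCast, ← Real.rpow_mul (by positivity), hα n hn, one_div_mul_eq_div,
      div_le_one (by positivity)]
    apply Real.rpow_le_rpow_of_exponent_le (by linarith [Nat.cast_nonneg (α := ℝ) n])
    norm_num; linarith
  have hS : ∀ n : ℕ, ∑ i ∈ Finset.Icc 1 n, α i ≤ 5 * ((n : ℝ) + 1) ^ (1 / 5 : ℝ) := by
    intro n
    induction n with
    | zero => simp
    | succ n ih =>
      rw [Finset.sum_Icc_succ_top (by omega)]
      have h1 := ht1 n
      have h5 := ht5 n
      have h1' := ht1 (n + 1)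
      have h5' := ht5 (n + 1)
      have h4 := hα4 (n + 1) (by omega)
      set t := ((n : ℝ) + 1) ^ (1 / 5 : ℝ)
      set s := (((n + 1 : ℕ) : ℝ) + 1) ^ (1 / 5 : ℝ)
      have hd : s ^ 5 - t ^ 5 = 1 := by rw [h5, h5']; push_cast; ring
      have hts : t ≤ s := by
        by_contra hh
        push Not at hh
        have := pow_le_pow_left₀ (by linarith) hh.le 5
        linarith
      have hk : 1 ≤ 5 * (s - t) * s ^ 4 := by
        have e : s ^ 5 - t ^ 5 = (s - t) * (s ^ 4 + s ^ 3 * t + s ^ 2 * t ^ 2 + s * t ^ 3 + t ^ 4) := by ring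
        have b1 : s ^ 3 * t ≤ s ^ 3 * s := by gcongr
        have b2 : s ^ 2 * t ^ 2 ≤ s ^ 2 * s ^ 2 := by gcongr
        have b3 : s * t ^ 3 ≤ s * s ^ 3 := by gcongr
        have b4 : t ^ 4 ≤ s ^ 4 := by gcongr
        have b5 : (s ^ 4 + s ^ 3 * t + s ^ 2 * t ^ 2 + s * t ^ 3 + t ^ 4) ≤ 5 * s ^ 4 := by
          nlinarith
        have := mul_le_mul_of_nonneg_left b5 (sub_nonneg.2 hts)
        linarith
      have : α (n + 1) ≤ 5 * (s - t) :=
        le_of_mul_le_mul_right (h4.trans hk) (by positivity)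
      linarith
  have hrS : ∀ n ≥ 1, Real.sqrt (α n) * ∑ i ∈ Finset.Icc 1 n, α i ≤ 5 := by
    intro n hn
    have h1 := ht1 n
    have h4 := hα4 n hn
    have hS' := hS n
    set t := ((n : ℝ) + 1) ^ (1 / 5 : ℝ)
    have h2 : Real.sqrt (α n) * t ^ 2 ≤ 1 := by
      rw [← hsq n hn] at h4
      have : (Real.sqrt (α n) * t ^ 2) ^ 2 ≤ 1 := by linarith
      exact (sq_le_one_iff₀ (by positivity)).1 this
    have h3 : Real.sqrt (α n) * t ≤ Real.sqrt (α n) * t ^ 2 := by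
      apply mul_le_mul_of_nonneg_left _ (hrpos n hn).le
      nlinarith
    have := mul_le_mul_of_nonneg_left hS' (hrpos n hn).le
    linarith
  have hτmono : ∀ m n : ℕ, m ≤ n → τ m ≤ τ n := by
    intro m n hmn
    rw [hτ, hτ]
    apply Finset.sum_le_sum_of_subset_of_nonneg (Finset.Icc_subset_Icc_right hmn)
    intro i hi _
    have hi1 := (Finset.mem_Icc.1 hi).1
    exact mul_nonneg (hαpos i hi1).le (by linarith [hαlt i hi1])
  have hτ1 : 0 < τ 1 := by
    rw [hτ]; simp
    exact mul_pos (hαpos 1 le_rfl) (by linarith [hαlt 1 le_rfl])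
  refine ⟨C₁ + 6 * C₂ / τ 1 + 3 * C₃ + 15 * C₄, fun n hn => ?_⟩
  rw [hω]
  have hτn : τ 1 ≤ τ n := hτmono 1 n hn
  have hτ0 : 0 < τ n := hτ1.trans_le hτn
  have hr := hrpos n hn
  have hr' := hrpos (n + 1) (by omega)
  have e2 : 6 * C₂ * Real.sqrt (α (n + 1)) ≤ 6 * C₂ / τ 1 * τ n * Real.sqrt (α (n + 1)) := by
    apply mul_le_mul_of_nonneg_right _ hr'.le
    rw [div_mul_eq_mul_div, le_div_iff₀ hτ1]
    exact mul_le_mul_of_nonneg_left hτn (by positivity)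
  have e3 : C₃ * α n * τ n ≤ 3 * C₃ * τ n * Real.sqrt (α (n + 1)) := by
    have : α n ≤ 3 * Real.sqrt (α (n + 1)) := by
      nlinarith [hsq n hn, hr1 n hn, F3 n hn]
    have := mul_le_mul_of_nonneg_left this (by positivity : 0 ≤ C₃ * τ n)
    linarith
  have e4 : C₄ * α n * ∑ i ∈ Finset.Icc 1 n, α i * τ i
      ≤ 15 * C₄ * τ n * Real.sqrt (α (n + 1)) := by
    have h1 : ∑ i ∈ Finset.Icc 1 n, α i * τ i ≤ (∑ i ∈ Finset.Icc 1 n, α i) * τ n := by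
      rw [Finset.sum_mul]
      apply Finset.sum_le_sum
      intro i hi
      obtain ⟨hi1, hi2⟩ := Finset.mem_Icc.1 hi
      exact mul_le_mul_of_nonneg_left (hτmono i n hi2) (hαpos i hi1).le
    have h2 := mul_le_mul_of_nonneg_left h1 (mul_nonneg hC₄ (hαpos n hn).le)
    have h3 : α n * ∑ i ∈ Finset.Icc 1 n, α i ≤ 15 * Real.sqrt (α (n + 1)) := by
      have := mul_le_mul_of_nonneg_left (hrS n hn) hr.le
      have h5 : Real.sqrt (α n) * (Real.sqrt (α n) * ∑ i ∈ Finset.Icc 1 n, α i)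
          = α n * ∑ i ∈ Finset.Icc 1 n, α i := by
        rw [← mul_assoc, ← sq, hsq n hn]
      rw [h5] at this
      linarith [F3 n hn]
    have h4 := mul_le_mul_of_nonneg_left h3 (by positivity : 0 ≤ C₄ * τ n)
    linarith
  have e1 := hs n
  linarith
end
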